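/- Let (h, q) with h > 0 be a smooth solution of the dispersive Serre–Green–Naghdi model with topography on ℝ^d × (0,∞). Define q₁ := h², q₃ := q·∇z, q₂ := −h² div v + (3/2) q₃, ts := h k̇, and s := −h ḧ − (3/2) ts. Then (h, q, q₁, q₂, q₃) satisfies the first-order system: ∂_t h + div q = 0; ∂_t q + div(v ⊗ q) + ∇((1/2)g h² − (1/3) h s) = −(g h − (1/2)s + (1/4)ts)∇z; ∂_t q₁ + div(v q₁) = q₂ − (3/2) q₃; ∂_t q₂ + div(v q₂) = −s; ∂_t q₃ + div(v q₃) = ts; together with the constraints q₁ = h² and q₃ = q·∇z. -/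

import Mathlib

noncomputable section
open scoped BigOperators

/-- Physical space `ℝ^d`. -/
abbrev Spc (d : ℕ) := EuclideanSpace ℝ (Fin d)
/-- Space-time `ℝ^d × ℝ` (time is the second component). -/
abbrev SpT (d : ℕ) := Spc d × ℝ

/-- Time derivative `∂_t f`. -/
noncomputable def dT {d : ℕ} (f : SpT d → ℝ) (p : SpT d) : ℝ :=
  deriv (fun t => f (p.1, t)) p.2

/-- `i`-th spatial partial derivative `∂_i f` of a space-time function. -/
noncomputable def dX {d : ℕ} (i : Fin d) (f : SpT d → ℝ) (p : SpT d) : ℝ :=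
  fderiv ℝ (fun x => f (x, p.2)) p.1 (EuclideanSpace.single i 1)

/-- `i`-th spatial partial derivative `∂_i z` of a time-independent function. -/
noncomputable def dZ {d : ℕ} (i : Fin d) (z : Spc d → ℝ) (x : Spc d) : ℝ :=
  fderiv ℝ z x (EuclideanSpace.single i 1)

/-- Divergence `div u = ∑_i ∂_i u_i` of a vector field. -/
noncomputable def divF {d : ℕ} (u : SpT d → Spc d) (p : SpT d) : ℝ :=
  ∑ i, dX i (fun q => u q i) p

/-- Divergence `div (f v) = ∑_i ∂_i (v_i f)` of a scalar multiple of a vector field. -/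
noncomputable def divSV {d : ℕ} (v : SpT d → Spc d) (f : SpT d → ℝ) (p : SpT d) : ℝ :=
  ∑ i, dX i (fun q => v q i * f q) p

/-- Advection term `v·∇f`. -/
noncomputable def adv {d : ℕ} (v : SpT d → Spc d) (f : SpT d → ℝ) (p : SpT d) : ℝ :=
  ∑ i, v p i * dX i f p

/-- `v·∇z` for the (time-independent) bathymetry `z`. -/
noncomputable def advZ {d : ℕ} (v : SpT d → Spc d) (z : Spc d → ℝ) (p : SpT d) : ℝ :=
  ∑ i, v p i * dZ i z p.1

/-- The time derivative as a directional derivative in space-time. -/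
lemma dT_eq_fderiv {d : ℕ} {f : SpT d → ℝ} {p : SpT d} (hf : DifferentiableAt ℝ f p) :
    dT f p = fderiv ℝ f p (0, 1) := by
  have hc : HasDerivAt (fun t : ℝ => ((p.1, t) : SpT d)) (0, 1) p.2 :=
    (hasDerivAt_const p.2 p.1).prodMk (hasDerivAt_id p.2)
  exact (hf.hasFDerivAt.comp_hasDerivAt (f := fun t : ℝ => ((p.1, t) : SpT d)) p.2 hc).deriv

/-- A spatial partial derivative as a directional derivative in space-time. -/
lemma dX_eq_fderiv {d : ℕ} {f : SpT d → ℝ} {p : SpT d} (i : Fin d)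
    (hf : DifferentiableAt ℝ f p) :
    dX i f p = fderiv ℝ f p (EuclideanSpace.single i 1, 0) := by
  have hc : HasFDerivAt (fun x : Spc d => ((x, p.2) : SpT d))
      (ContinuousLinearMap.inl ℝ (Spc d) ℝ) p.1 := hasFDerivAt_prodMk_left p.1 p.2
  have := (hf.hasFDerivAt.comp (f := fun x : Spc d => ((x, p.2) : SpT d)) p.1 hc).fderiv
  unfold dX
  simp only [Function.comp_def] at this
  simp [this]

lemma ContDiff.dT {d : ℕ} {f : SpT d → ℝ} (hf : ContDiff ℝ (⊤ : ℕ∞) f) :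
    ContDiff ℝ (⊤ : ℕ∞) (dT f) := by
  have : _root_.dT f = fun p => fderiv ℝ f p (0, 1) :=
    funext fun p => dT_eq_fderiv (hf.differentiable (by simp) p)
  rw [this]
  exact (hf.fderiv_right (by simp)).clm_apply contDiff_const

lemma ContDiff.dX {d : ℕ} {f : SpT d → ℝ} (i : Fin d) (hf : ContDiff ℝ (⊤ : ℕ∞) f) :
    ContDiff ℝ (⊤ : ℕ∞) (dX i f) := by
  have : _root_.dX i f = fun p => fderiv ℝ f p (EuclideanSpace.single i 1, 0) :=
    funext fun p => dX_eq_fderiv i (hf.differentiable (by simp) p)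
  rw [this]
  exact (hf.fderiv_right (by simp)).clm_apply contDiff_const

lemma ContDiff.dZ {d : ℕ} {z : Spc d → ℝ} (i : Fin d) (hz : ContDiff ℝ (⊤ : ℕ∞) z) :
    ContDiff ℝ (⊤ : ℕ∞) (dZ i z) :=
  (hz.fderiv_right (by simp)).clm_apply contDiff_const

lemma ContDiff.adv {d : ℕ} {v : SpT d → Spc d} {f : SpT d → ℝ}
    (hv : ContDiff ℝ (⊤ : ℕ∞) v) (hf : ContDiff ℝ (⊤ : ℕ∞) f) :
    ContDiff ℝ (⊤ : ℕ∞) (adv v f) :=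
  ContDiff.sum fun i _ => ((contDiff_euclidean.1 hv) i).mul (hf.dX i)

lemma ContDiff.advZ {d : ℕ} {v : SpT d → Spc d} {z : Spc d → ℝ}
    (hv : ContDiff ℝ (⊤ : ℕ∞) v) (hz : ContDiff ℝ (⊤ : ℕ∞) z) :
    ContDiff ℝ (⊤ : ℕ∞) (advZ v z) :=
  ContDiff.sum fun i _ => ((contDiff_euclidean.1 hv) i).mul ((hz.dZ i).comp contDiff_fst)

lemma dT_congr_of_pos {d : ℕ} {f f' : SpT d → ℝ} (hff' : ∀ p : SpT d, 0 < p.2 → f p = f' p)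
    {p : SpT d} (hp : 0 < p.2) : dT f p = dT f' p := by
  refine Filter.EventuallyEq.deriv_eq ?_
  filter_upwards [lt_mem_nhds hp] with t ht using hff' (p.1, t) ht

lemma divSV_congr_of_pos {d : ℕ} (v : SpT d → Spc d) {f f' : SpT d → ℝ}
    (hff' : ∀ p : SpT d, 0 < p.2 → f p = f' p) {p : SpT d} (hp : 0 < p.2) :
    divSV v f p = divSV v f' p := by
  have (x : Spc d) : f (x, p.2) = f' (x, p.2) := hff' (x, p.2) hp
  simp only [divSV, dX, this]

lemma dT_mul {d : ℕ} {f f' : SpT d → ℝ} {p : SpT d} (hf : DifferentiableAt ℝ f p)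
    (hf' : DifferentiableAt ℝ f' p) :
    dT (fun q => f q * f' q) p = f p * dT f' p + f' p * dT f p := by
  rw [dT_eq_fderiv (hf.fun_mul hf'), dT_eq_fderiv hf, dT_eq_fderiv hf', fderiv_fun_mul hf hf']
  simp

lemma dX_mul {d : ℕ} (i : Fin d) {f f' : SpT d → ℝ} {p : SpT d} (hf : DifferentiableAt ℝ f p)
    (hf' : DifferentiableAt ℝ f' p) :
    dX i (fun q => f q * f' q) p = f p * dX i f' p + f' p * dX i f p := by
  rw [dX_eq_fderiv i (hf.fun_mul hf'), dX_eq_fderiv i hf, dX_eq_fderiv i hf',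
    fderiv_fun_mul hf hf']
  simp

/-- Product rule `div (f v) = v·∇f + f div v`. -/
lemma divSV_eq {d : ℕ} {v : SpT d → Spc d} {f : SpT d → ℝ} {p : SpT d}
    (hv : DifferentiableAt ℝ v p) (hf : DifferentiableAt ℝ f p) :
    divSV v f p = adv v f p + f p * divF v p := by
  simp only [divSV, adv, divF, Finset.mul_sum, ← Finset.sum_add_distrib]
  exact Finset.sum_congr rfl fun i _ => dX_mul i ((differentiableAt_euclidean.1 hv) i) hf

lemma adv_mul {d : ℕ} (v : SpT d → Spc d) {f f' : SpT d → ℝ} {p : SpT d}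
    (hf : DifferentiableAt ℝ f p) (hf' : DifferentiableAt ℝ f' p) :
    adv v (fun q => f q * f' q) p = f p * adv v f' p + f' p * adv v f p := by
  simp only [adv, dX_mul _ hf hf', Finset.mul_sum, ← Finset.sum_add_distrib]
  exact Finset.sum_congr rfl fun i _ => by ring

lemma dT_add_const_mul {d : ℕ} {f f' : SpT d → ℝ} {p : SpT d} (c : ℝ)
    (hf : DifferentiableAt ℝ f p) (hf' : DifferentiableAt ℝ f' p) :
    dT (fun q => f q + c * f' q) p = dT f p + c * dT f' p := by
  rw [dT_eq_fderiv (hf.fun_add (hf'.const_mul c)), dT_eq_fderiv hf, dT_eq_fderiv hf',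
    fderiv_fun_add hf (hf'.const_mul c), fderiv_const_mul hf']
  simp

lemma adv_add_const_mul {d : ℕ} (v : SpT d → Spc d) {f f' : SpT d → ℝ} {p : SpT d} (c : ℝ)
    (hf : DifferentiableAt ℝ f p) (hf' : DifferentiableAt ℝ f' p) :
    adv v (fun q => f q + c * f' q) p = adv v f p + c * adv v f' p := by
  simp only [adv, Finset.mul_sum, ← Finset.sum_add_distrib]
  refine Finset.sum_congr rfl fun i _ => ?_
  rw [dX_eq_fderiv i (hf.fun_add (hf'.const_mul c)), dX_eq_fderiv i hf, dX_eq_fderiv i hf',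
    fderiv_fun_add hf (hf'.const_mul c), fderiv_const_mul hf']
  simp
  ring

/-- If `h` satisfies the continuity equation, then the conservative derivative of `h f` is `h` times
the material derivative of `f`. -/
lemma dT_add_divSV_mul {d : ℕ} {v : SpT d → Spc d} {h f : SpT d → ℝ} {p : SpT d}
    (hv : DifferentiableAt ℝ v p) (hh : DifferentiableAt ℝ h p) (hf : DifferentiableAt ℝ f p)
    (mass : dT h p + divSV v h p = 0) :
    dT (fun q => h q * f q) p + divSV v (fun q => h q * f q) p
      = h p * (dT f p + adv v f p) := by
  rw [divSV_eq hv hh] at mass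
  rw [divSV_eq hv (hh.fun_mul hf), dT_mul hh hf, adv_mul v hh hf]
  linear_combination f p * mass

/-- A smooth solution of the dispersive Serre--Green--Naghdi model,
together with `q₁ := h²`, `q₃ := q·∇z`, `q₂ := -h² div v + (3/2) q₃`, `ts := h k̇` and
`s := -h ḧ - (3/2) ts`, satisfies the first-order system with the two algebraic constraints. -/
theorem sgn_first_order_reformulation
    {d : ℕ} (g : ℝ) (hg : 0 < g)
    (z : Spc d → ℝ) (zsm : ContDiff ℝ (⊤ : ℕ∞) z)
    (h : SpT d → ℝ) (Q : SpT d → Spc d)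
    (hsm : ContDiff ℝ (⊤ : ℕ∞) h) (Qsm : ContDiff ℝ (⊤ : ℕ∞) Q)
    (hpos : ∀ p : SpT d, 0 < h p)
    (v : SpT d → Spc d) (hv : ∀ p, v p = (h p)⁻¹ • Q p)
    (hdot : SpT d → ℝ) (hhdot : ∀ p, hdot p = dT h p + adv v h p)
    (hddot : SpT d → ℝ) (hhddot : ∀ p, hddot p = dT hdot p + adv v hdot p)
    (kdot : SpT d → ℝ)
    (hkdot : ∀ p, kdot p = dT (fun q => advZ v z q) p + adv v (fun q => advZ v z q) p)
    (P : SpT d → ℝ)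
    (hP : ∀ p, P p = (1/2) * g * (h p)^2 + (h p)^2 * ((1/3) * hddot p + (1/2) * kdot p))
    (R : SpT d → ℝ)
    (hR : ∀ p, R p = g * h p + h p * ((1/2) * hddot p + kdot p))
    -- `(h, q)` solves the dispersive Serre--Green--Naghdi model on `ℝ^d × (0,∞)`
    (mass : ∀ p : SpT d, 0 < p.2 → dT h p + divF Q p = 0)
    (momentum : ∀ p : SpT d, 0 < p.2 → ∀ i : Fin d,
      dT (fun q => Q q i) p + (∑ j, dX j (fun q => v q j * Q q i) p)
        + dX i P p + R p * dZ i z p.1 = 0)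
    -- the auxiliary variables
    (q₁ q₂ q₃ ts s : SpT d → ℝ)
    (hq₁ : ∀ p, q₁ p = (h p)^2)
    (hq₃ : ∀ p, q₃ p = ∑ i, Q p i * dZ i z p.1)
    (hq₂ : ∀ p, q₂ p = -(h p)^2 * divF v p + (3/2) * q₃ p)
    (hts : ∀ p, ts p = h p * kdot p)
    (hs : ∀ p, s p = -(h p) * hddot p - (3/2) * ts p) :
    -- the first-order system holds
    (∀ p : SpT d, 0 < p.2 → dT h p + divF Q p = 0) ∧
    (∀ p : SpT d, 0 < p.2 → ∀ i : Fin d,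
      dT (fun q => Q q i) p + (∑ j, dX j (fun q => v q j * Q q i) p)
        + dX i (fun q => (1/2) * g * (h q)^2 - (1/3) * h q * s q) p
        + (g * h p - (1/2) * s p + (1/4) * ts p) * dZ i z p.1 = 0) ∧
    (∀ p : SpT d, 0 < p.2 → dT q₁ p + divSV v q₁ p = q₂ p - (3/2) * q₃ p) ∧
    (∀ p : SpT d, 0 < p.2 → dT q₂ p + divSV v q₂ p = -(s p)) ∧
    (∀ p : SpT d, 0 < p.2 → dT q₃ p + divSV v q₃ p = ts p) ∧
    -- together with the constraints
    (∀ p : SpT d, q₁ p = (h p)^2) ∧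
    (∀ p : SpT d, q₃ p = ∑ i, Q p i * dZ i z p.1) := by
  have vsm : ContDiff ℝ (⊤ : ℕ∞) v := by
    rw [show v = fun p => (h p)⁻¹ • Q p from funext hv]
    exact (hsm.inv fun p => (hpos p).ne').smul Qsm
  have hdotsm : ContDiff ℝ (⊤ : ℕ∞) hdot := by
    rw [show hdot = fun p => dT h p + adv v h p from funext hhdot]
    exact hsm.dT.add (vsm.adv hsm)
  have vd : Differentiable ℝ v := vsm.differentiable (by simp)
  have hd : Differentiable ℝ h := hsm.differentiable (by simp)
  have hdotd : Differentiable ℝ hdot := hdotsm.differentiable (by simp)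
  have wd : Differentiable ℝ (advZ v z) := (vsm.advZ zsm).differentiable (by simp)
  have hvQ (p : SpT d) (i : Fin d) : v p i * h p = Q p i := by
    have := (hpos p).ne'
    simp [hv]
    field_simp
  have mass' (p : SpT d) (hp : 0 < p.2) : dT h p + divSV v h p = 0 := by
    simpa only [divSV, hvQ, divF] using mass p hp
  have hdot_eq (p : SpT d) (hp : 0 < p.2) : hdot p = -(h p) * divF v p := by
    have := mass' p hp
    rw [divSV_eq (vd p) (hd p)] at this
    linear_combination hhdot p + this
  have q₃_eq (p : SpT d) : q₃ p = h p * advZ v z p := by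
    simp only [hq₃, advZ, Finset.mul_sum, ← hvQ]
    exact Finset.sum_congr rfl fun i _ => by ring
  have q₂_eq (p : SpT d) (hp : 0 < p.2) : q₂ p = h p * (hdot p + 3 / 2 * advZ v z p) := by
    rw [hq₂, q₃_eq, hdot_eq p hp]
    ring
  refine ⟨mass, fun p hp i => ?_, fun p hp => ?_, fun p hp => ?_, fun p hp => ?_, hq₁, hq₃⟩
  · have hPs : (fun q => (1/2) * g * (h q)^2 - (1/3) * h q * s q) = P := by
      funext q
      rw [hP, hs, hts]
      ring
    rw [hPs, hs, hts]
    linear_combination momentum p hp i - dZ i z p.1 * hR p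
  · rw [show q₁ = fun p => h p * h p from funext fun p => by rw [hq₁, sq],
      dT_add_divSV_mul (vd p) (hd p) (hd p) (mass' p hp), ← hhdot, hdot_eq p hp, hq₂]
    ring
  · rw [dT_congr_of_pos q₂_eq hp, divSV_congr_of_pos v q₂_eq hp,
      dT_add_divSV_mul (f := fun q => hdot q + 3 / 2 * advZ v z q) (vd p) (hd p)
        ((hdotd p).fun_add ((wd p).const_mul _)) (mass' p hp),
      dT_add_const_mul _ (hdotd p) (wd p), adv_add_const_mul v _ (hdotd p) (wd p), hs, hts]
    linear_combination -(h p) * hhddot p - 3 / 2 * h p * hkdot p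
  · rw [funext q₃_eq, dT_add_divSV_mul (vd p) (hd p) (wd p) (mass' p hp), hts, hkdot]
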